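/- Let γ be a metric graph isometric to a circle and let v ∈ γ. Then (1) for every effective divisor F of degree n on γ there exists a point Q ∈ γ such that F + Q is linearly equivalent to (n + 1)·v on γ; and (2) every effective divisor of degree n ≥ 1 on γ is linearly equivalent on γ to a divisor of the form m·v + E where m ≥ 0 is an integer and E is an effective divisor of degree at most 1. -/

import Mathlib

noncomputable section

/-- The star with `n` rays of radius `r` in the complex plane:
`{ z ∈ ℂ : z = t·e^{2πik/n}, t ∈ [0,r], k ∈ ℤ }`. -/
def starSet (n : ℕ) (r : ℝ) : Set ℂ :=
  {z | ∃ t ∈ Set.Icc (0 : ℝ) r, ∃ k : ℤ,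
    z = (t : ℂ) * Complex.exp (2 * (Real.pi : ℂ) * Complex.I * (k : ℂ) / (n : ℂ))}

/-- `P` has a neighbourhood isometric to a star with `n` rays of some radius `r > 0`,
with `P` corresponding to `0`. -/
def HasStarNbhd (Γ : Type*) [MetricSpace Γ] (P : Γ) (n : ℕ) : Prop :=
  ∃ r > (0 : ℝ), ∃ U ∈ nhds P, ∃ φ : Γ → ℂ,
    φ P = 0 ∧ φ '' U = starSet n r ∧
    ∀ x ∈ U, ∀ y ∈ U, dist (φ x) (φ y) = dist x y

/-- A metric graph: a compact connected metric space in which every point has a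
neighbourhood isometric to a star with `n ≥ 1` rays. -/
def IsMetricGraph (Γ : Type*) [MetricSpace Γ] : Prop :=
  CompactSpace Γ ∧ ConnectedSpace Γ ∧ ∀ P : Γ, ∃ n : ℕ, 1 ≤ n ∧ HasStarNbhd Γ P n

/-- The valence of a point: the number of rays of a star neighbourhood. -/
noncomputable def valence (Γ : Type*) [MetricSpace Γ] (P : Γ) : ℕ :=
  sInf {n : ℕ | 1 ≤ n ∧ HasStarNbhd Γ P n}

/-- A vertex is a point of valence different from `2`. -/
def IsVertex (Γ : Type*) [MetricSpace Γ] (P : Γ) : Prop := valence Γ P ≠ 2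

/-- The genus of a metric graph: `#edges - #vertices + 1`, the edges being the connected
components of the complement of the vertex set. -/
noncomputable def graphGenus (Γ : Type*) [MetricSpace Γ] : ℤ :=
  (Nat.card (ConnectedComponents {P : Γ // ¬ IsVertex Γ P}) : ℤ)
    - (Nat.card {P : Γ // IsVertex Γ P} : ℤ) + 1

/-- A divisor on `Γ` : a finitely supported formal `ℤ`-linear combination of points. -/
abbrev Divisor (Γ : Type*) : Type _ := Γ →₀ ℤ

/-- The degree of a divisor. -/
def divDeg {Γ : Type*} (D : Divisor Γ) : ℤ := D.sum fun _ n => n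

/-- A divisor is effective if all its coefficients are nonnegative. -/
def Effective {Γ : Type*} (D : Divisor Γ) : Prop := ∀ P : Γ, 0 ≤ D P

/-- An arc based at `P` : an isometric parametrization of a segment emanating from `P`. -/
def IsArcAt {Γ : Type*} [MetricSpace Γ] (P : Γ) (τ : ℝ → Γ) : Prop :=
  τ 0 = P ∧ ∃ a > (0 : ℝ), ∀ s ∈ Set.Icc (0 : ℝ) a, ∀ t ∈ Set.Icc (0 : ℝ) a,
    dist (τ s) (τ t) = |s - t|

/-- Two arcs are equivalent (define the same tangent direction) when they agree near `0`. -/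
def ArcEquiv {Γ : Type*} (τ τ' : ℝ → Γ) : Prop :=
  ∃ ε > (0 : ℝ), ∀ t ∈ Set.Icc (0 : ℝ) ε, τ t = τ' t

/-- `f` has (one-sided) slope `s` along the arc `τ`. -/
def HasSlopeAlong {Γ : Type*} (f : Γ → ℝ) (τ : ℝ → Γ) (s : ℤ) : Prop :=
  ∃ ε > (0 : ℝ), ∀ t ∈ Set.Icc (0 : ℝ) ε, f (τ t) = f (τ 0) + (s : ℝ) * t

/-- A rational function on a metric graph: continuous and piecewise affine with
integer slopes, i.e. having an integer slope along every arc. -/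
def IsRational (Γ : Type*) [MetricSpace Γ] (f : Γ → ℝ) : Prop :=
  Continuous f ∧ ∀ (P : Γ) (τ : ℝ → Γ), IsArcAt P τ → ∃ s : ℤ, HasSlopeAlong f τ s

/-- `div f` has coefficient `m` at `P`: the sum of the slopes of `f` in all tangent
directions emanating from `P` equals `m`. -/
def HasOrderAt (Γ : Type*) [MetricSpace Γ] (f : Γ → ℝ) (P : Γ) (m : ℤ) : Prop :=
  ∃ (n : ℕ) (τ : Fin n → ℝ → Γ) (s : Fin n → ℤ),
    (∀ i, IsArcAt P (τ i)) ∧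
    Pairwise (fun i j => ¬ ArcEquiv (τ i) (τ j)) ∧
    (∀ σ : ℝ → Γ, IsArcAt P σ → ∃ i, ArcEquiv σ (τ i)) ∧
    (∀ i, HasSlopeAlong f (τ i) (s i)) ∧
    m = ∑ i, s i

/-- Linear equivalence of divisors: `D₂ - D₁ = div f` for some rational function `f`. -/
def LinEquiv (Γ : Type*) [MetricSpace Γ] (D₁ D₂ : Divisor Γ) : Prop :=
  ∃ f : Γ → ℝ, IsRational Γ f ∧ ∀ P : Γ, HasOrderAt Γ f P (D₂ P - D₁ P)

/-- `D` is linearly equivalent to an effective divisor. -/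
def EquivEffective (Γ : Type*) [MetricSpace Γ] (D : Divisor Γ) : Prop :=
  ∃ D' : Divisor Γ, Effective D' ∧ LinEquiv Γ D D'

/-- For every effective divisor `E` of degree `r`, `D - E` is linearly equivalent to an
effective divisor. -/
def RankGE (Γ : Type*) [MetricSpace Γ] (D : Divisor Γ) (r : ℕ) : Prop :=
  ∀ E : Divisor Γ, Effective E → divDeg E = (r : ℤ) → EquivEffective Γ (D - E)

/-- The rank of a divisor: `-1` if `D` is not equivalent to an effective divisor, and
otherwise the largest `r ≥ 0` such that `D - E` is equivalent to an effective divisor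
for every effective `E` of degree `r`. -/
noncomputable def divRank (Γ : Type*) [MetricSpace Γ] (D : Divisor Γ) : ℤ :=
  sSup (insert (-1) {n : ℤ | ∃ r : ℕ, n = (r : ℤ) ∧ RankGE Γ D r})

/-- The arc `τ` immediately leaves the set `X`. -/
def ArcLeaves {Γ : Type*} (X : Set Γ) (τ : ℝ → Γ) : Prop :=
  ∃ ε > (0 : ℝ), ∀ t ∈ Set.Ioc (0 : ℝ) ε, τ t ∉ X

/-- `P` is a non-saturated boundary point of `X` with respect to `D` : the number of
tangent directions at `P` leaving `X` is strictly greater than `D P`. -/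
def NonSaturated (Γ : Type*) [MetricSpace Γ] (D : Divisor Γ) (X : Set Γ) (P : Γ) : Prop :=
  P ∈ frontier X ∧ ∃ (n : ℕ) (τ : Fin n → ℝ → Γ),
    (∀ i, IsArcAt P (τ i)) ∧ (∀ i, ArcLeaves X (τ i)) ∧
    Pairwise (fun i j => ¬ ArcEquiv (τ i) (τ j)) ∧ D P < (n : ℤ)

/-- `D` is `P₀`-reduced. -/
def IsReducedDivisor (Γ : Type*) [MetricSpace Γ] (D : Divisor Γ) (P₀ : Γ) : Prop :=
  (∀ P : Γ, P ≠ P₀ → 0 ≤ D P) ∧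
  ∀ X : Set Γ, IsClosed X → X.Nonempty → P₀ ∉ X → ∃ P, NonSaturated Γ D X P

/-- The restriction of a divisor on `Γ` to a divisor on a subset `S` (with the induced
metric); divisors supported on `S` are identified with divisors on `S` this way. -/
noncomputable def DivRestrict {Γ : Type*} (S : Set Γ) (D : Divisor Γ) : Divisor ↥S :=
  Finsupp.comapDomain Subtype.val D Subtype.coe_injective.injOn

/-- Linear equivalence computed on the subgraph `S` of `Γ`. -/
def LinEquivOn {Γ : Type*} [MetricSpace Γ] (S : Set Γ) (D₁ D₂ : Divisor Γ) : Prop :=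
  LinEquiv ↥S (DivRestrict S D₁) (DivRestrict S D₂)

/-- The rank computed on the subgraph `S` of `Γ`. -/
noncomputable def divRankOn {Γ : Type*} [MetricSpace Γ] (S : Set Γ) (D : Divisor Γ) : ℤ :=
  divRank ↥S (DivRestrict S D)

/-- A free divisor: effective, of rank at least one, and removing any point decreases
the rank. -/
def IsFreeDivisor (Γ : Type*) [MetricSpace Γ] (D : Divisor Γ) : Prop :=
  Effective D ∧ 1 ≤ divRank Γ D ∧
  ∀ P : Γ, divRank Γ (D - Finsupp.single P 1) < divRank Γ D

/-- The canonical divisor `K_Γ = Σ_P (val(P) - 2)·P`. -/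
def IsCanonical (Γ : Type*) [MetricSpace Γ] (K : Divisor Γ) : Prop :=
  ∀ P : Γ, K P = (valence Γ P : ℤ) - 2

/-- A very special divisor: effective with `rk(D) > 0` and `rk(K_Γ - D) > 0`. -/
def VerySpecial (Γ : Type*) [MetricSpace Γ] (D : Divisor Γ) : Prop :=
  Effective D ∧ 0 < divRank Γ D ∧
  ∃ K : Divisor Γ, IsCanonical Γ K ∧ 0 < divRank Γ (K - D)

/-- `φ` is an `L`-periodic locally isometric parametrization of the circle `S ⊆ Γ`
of circumference `L`. -/
def CircleParam {Γ : Type*} [MetricSpace Γ] (S : Set Γ) (L : ℝ) (φ : ℝ → Γ) : Prop :=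
  0 < L ∧ (∀ t : ℝ, φ (t + L) = φ t) ∧ Set.range φ = S ∧
  ∀ s t : ℝ, |s - t| ≤ L / 2 → dist (φ s) (φ t) = |s - t|

/-- `S` is a metric circle inside `Γ`. -/
def IsCircleSet {Γ : Type*} [MetricSpace Γ] (S : Set Γ) : Prop :=
  ∃ (L : ℝ) (φ : ℝ → Γ), CircleParam S L φ

end

section LocalCharts

variable {γ : Type*} [MetricSpace γ]

/-- The closed ball of radius `δ` around `P` is isometrically parametrized by `[-δ, δ]`. -/
def HasLineChart (δ : ℝ) (P : γ) : Prop :=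
  ∃ ψ : ℝ → γ, ψ 0 = P ∧
    (∀ s t : ℝ, |s| ≤ δ → |t| ≤ δ → dist (ψ s) (ψ t) = |s - t|) ∧
    ∀ x, dist x P ≤ δ → ∃ t : ℝ, |t| ≤ δ ∧ ψ t = x

/-- A curve which is isometric on all segments of length at most `δ`. -/
def IsLocalGeodesic (δ : ℝ) (φ : ℝ → γ) : Prop :=
  ∀ s t : ℝ, |s - t| ≤ δ → dist (φ s) (φ t) = |s - t|

theorem ofReal_mem_starSet_two {r t : ℝ} (ht : |t| ≤ r) : (t : ℂ) ∈ starSet 2 r := by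
  rcases le_total 0 t with h | h
  · refine ⟨t, ⟨h, by rwa [abs_of_nonneg h] at ht⟩, 0, by simp⟩
  · refine ⟨-t, ⟨by linarith, by rwa [abs_of_nonpos h] at ht⟩, 1, ?_⟩
    have : 2 * (Real.pi : ℂ) * Complex.I * ((1 : ℤ) : ℂ) / ((2 : ℕ) : ℂ)
        = Real.pi * Complex.I := by
      push_cast; ring
    rw [this, Complex.exp_pi_mul_I]
    push_cast; ring

theorem exists_ofReal_of_mem_starSet_two {r : ℝ} {z : ℂ} (hz : z ∈ starSet 2 r) :
    ∃ t : ℝ, |t| ≤ r ∧ z = t := by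
  obtain ⟨t, ht, k, rfl⟩ := hz
  have h1 : 2 * (Real.pi : ℂ) * Complex.I * (k : ℂ) / ((2 : ℕ) : ℂ)
      = k * (Real.pi * Complex.I) := by
    push_cast; ring
  rw [h1, Complex.exp_int_mul, Complex.exp_pi_mul_I]
  rcases Int.even_or_odd k with hk | hk
  · exact ⟨t, by rw [abs_of_nonneg ht.1]; exact ht.2, by simp [hk.neg_one_zpow]⟩
  · exact ⟨-t, by rw [abs_neg, abs_of_nonneg ht.1]; exact ht.2, by simp [hk.neg_one_zpow]⟩

theorem HasStarNbhd.exists_hasLineChart {P : γ} (h : HasStarNbhd γ P 2) :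
    ∃ δ > 0, HasLineChart δ P := by
  obtain ⟨r, hr, U, hU, φ, hφP, himg, hiso⟩ := h
  have hPU : P ∈ U := mem_of_mem_nhds hU
  obtain ⟨η, hη, hball⟩ := Metric.mem_nhds_iff.1 hU
  have hex : ∀ t : ℝ, ∃ y : γ, |t| ≤ r → y ∈ U ∧ φ y = t := by
    intro t
    by_cases ht : |t| ≤ r
    · have : (t : ℂ) ∈ φ '' U := himg ▸ ofReal_mem_starSet_two ht
      obtain ⟨y, hy, hyt⟩ := this
      exact ⟨y, fun _ => ⟨hy, hyt⟩⟩
    · exact ⟨P, fun h => absurd h ht⟩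
  choose ψ hψ using hex
  have hinj : ∀ x ∈ U, ∀ y ∈ U, φ x = φ y → x = y := by
    intro x hx y hy hxy
    rw [← dist_eq_zero, ← hiso x hx y hy, hxy, dist_self]
  have hδr : min r (η / 2) ≤ r := min_le_left _ _
  refine ⟨min r (η / 2), lt_min hr (by linarith), ψ, ?_, ?_, ?_⟩
  · have h0 := hψ 0 (by simpa using hr.le)
    exact hinj _ h0.1 _ hPU (by rw [h0.2, hφP]; simp)
  · intro s t hs ht
    obtain ⟨hs1, hs2⟩ := hψ s (hs.trans hδr)
    obtain ⟨ht1, ht2⟩ := hψ t (ht.trans hδr)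
    rw [← hiso _ hs1 _ ht1, hs2, ht2, Complex.dist_eq, ← Complex.ofReal_sub,
      Complex.norm_real, Real.norm_eq_abs]
  · intro x hx
    have hxU : x ∈ U := hball (by
      rw [Metric.mem_ball]
      have := min_le_right r (η / 2)
      linarith)
    obtain ⟨t, htr, ht⟩ :=
      exists_ofReal_of_mem_starSet_two (himg ▸ Set.mem_image_of_mem φ hxU)
    obtain ⟨h1, h2⟩ := hψ t htr
    refine ⟨t, ?_, hinj _ h1 _ hxU (by rw [h2, ht])⟩
    have := hiso x hxU P hPU
    rw [ht, hφP, dist_zero_right, Complex.norm_real, Real.norm_eq_abs] at this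
    rwa [this]

theorem HasLineChart.mono {δ δ' : ℝ} {P : γ} (h : HasLineChart δ P) (hδ : δ' ≤ δ) (h0 : 0 ≤ δ') :
    HasLineChart δ' P := by
  obtain ⟨ψ, h1, h2, h3⟩ := h
  refine ⟨ψ, h1, fun s t hs ht => h2 s t (hs.trans hδ) (ht.trans hδ), fun x hx => ?_⟩
  obtain ⟨t, ht, rfl⟩ := h3 x (hx.trans hδ)
  refine ⟨t, ?_, rfl⟩
  rwa [← h1, h2 t 0 ht (by simpa using h0.trans hδ), sub_zero] at hx

theorem HasLineChart.of_dist_le {δ : ℝ} {P Q : γ} (h : HasLineChart (2 * δ) P)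
    (hQ : dist Q P ≤ δ) : HasLineChart δ Q := by
  have hδ : 0 ≤ δ := dist_nonneg.trans hQ
  obtain ⟨ψ, h1, h2, h3⟩ := h
  obtain ⟨u, hu, rfl⟩ := h3 Q (by linarith)
  have huδ : |u| ≤ δ := by
    rwa [← h1, h2 u 0 hu (by simpa using hδ), sub_zero] at hQ
  have hshift : ∀ s : ℝ, |s| ≤ δ → |u + s| ≤ 2 * δ := fun s hs =>
    (abs_add_le u s).trans (by linarith)
  refine ⟨fun t => ψ (u + t), by simp, fun s t hs ht => ?_, fun x hx => ?_⟩
  · rw [h2 _ _ (hshift s hs) (hshift t ht)]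
    congr 1; ring
  · obtain ⟨w, hw, rfl⟩ := h3 x ((dist_triangle x (ψ u) P).trans (by linarith))
    refine ⟨w - u, ?_, by simp⟩
    rwa [h2 w u hw hu] at hx

theorem exists_uniform_hasLineChart [CompactSpace γ] (h : ∀ P : γ, HasStarNbhd γ P 2) :
    ∃ δ > 0, ∀ P : γ, HasLineChart δ P := by
  classical
  have hloc : ∀ P : γ, ∃ δ > 0, HasLineChart (2 * δ) P := fun P => by
    obtain ⟨δ, hδ, hc⟩ := (h P).exists_hasLineChart
    exact ⟨δ / 2, by linarith, by rwa [mul_div_cancel₀ _ two_ne_zero]⟩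
  choose r hr hc using hloc
  obtain ⟨T, hT⟩ := isCompact_univ.elim_finite_subcover (fun P : γ => Metric.ball P (r P))
    (fun P => Metric.isOpen_ball)
    (fun P _ => Set.mem_iUnion.2 ⟨P, Metric.mem_ball_self (hr P)⟩)
  obtain ⟨δ, hδ, hδT⟩ : ∃ δ > 0, ∀ P ∈ T, δ ≤ r P := by
    clear hT
    induction T using Finset.induction_on with
    | empty => exact ⟨1, one_pos, by simp⟩
    | insert a s _ ih =>
      obtain ⟨δ, hδ, hs⟩ := ih
      refine ⟨min δ (r a), lt_min hδ (hr a), fun P hP => ?_⟩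
      rcases Finset.mem_insert.1 hP with rfl | hP
      · exact min_le_right _ _
      · exact (min_le_left _ _).trans (hs P hP)
  refine ⟨δ, hδ, fun Q => ?_⟩
  obtain ⟨P, hP, hQ⟩ := Set.mem_iUnion₂.1 (hT (Set.mem_univ Q))
  exact ((hc P).of_dist_le (le_of_lt hQ)).mono (hδT P hP) hδ.le

end LocalCharts

section Geodesics

variable {γ : Type*} [MetricSpace γ] {δ : ℝ}

theorem HasLineChart.flip {P : γ} {ψ : ℝ → γ}
    (h : ψ 0 = P ∧ (∀ s t : ℝ, |s| ≤ δ → |t| ≤ δ → dist (ψ s) (ψ t) = |s - t|) ∧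
      ∀ x, dist x P ≤ δ → ∃ t : ℝ, |t| ≤ δ ∧ ψ t = x) :
    ψ (-0) = P ∧
      (∀ s t : ℝ, |s| ≤ δ → |t| ≤ δ → dist (ψ (-s)) (ψ (-t)) = |s - t|) ∧
      ∀ x, dist x P ≤ δ → ∃ t : ℝ, |t| ≤ δ ∧ ψ (-t) = x := by
  obtain ⟨h1, h2, h3⟩ := h
  refine ⟨by simpa using h1, fun s t hs ht => ?_, fun x hx => ?_⟩
  · rw [h2 _ _ (by simpa using hs) (by simpa using ht), ← abs_neg]
    congr 1; ring
  · obtain ⟨t, ht, rfl⟩ := h3 x hx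
    exact ⟨-t, by simpa using ht, by simp⟩

/-- A chart around `P` can be oriented so that it sends `-δ` to a prescribed point at
distance `δ` from `P`. -/
theorem HasLineChart.exists_oriented (hδ : 0 < δ) {P Q : γ} (h : HasLineChart δ P)
    (hQ : dist Q P = δ) :
    ∃ ψ : ℝ → γ, ψ 0 = P ∧ ψ (-δ) = Q ∧
      (∀ s t : ℝ, |s| ≤ δ → |t| ≤ δ → dist (ψ s) (ψ t) = |s - t|) ∧
      ∀ x, dist x P ≤ δ → ∃ t : ℝ, |t| ≤ δ ∧ ψ t = x := by
  obtain ⟨ψ, hψ⟩ := h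
  obtain ⟨t, ht, rfl⟩ := hψ.2.2 Q hQ.le
  have htδ : |t| = δ := by
    rwa [← hψ.1, hψ.2.1 t 0 ht (by simpa using hδ.le), sub_zero] at hQ
  rcases abs_eq hδ.le |>.1 htδ with rfl | rfl
  · obtain ⟨h1, h2, h3⟩ := HasLineChart.flip hψ
    exact ⟨fun t => ψ (-t), h1, by simp, h2, h3⟩
  · exact ⟨ψ, hψ.1, rfl, hψ.2⟩

theorem exists_geodesic_segment (hδ : 0 < δ) (h : ∀ P : γ, HasLineChart δ P) (P : γ) (n : ℕ) :
    ∃ φ : ℝ → γ, ∀ s ∈ Set.Icc 0 ((n + 1) * δ), ∀ t ∈ Set.Icc 0 ((n + 1) * δ),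
      |s - t| ≤ δ → dist (φ s) (φ t) = |s - t| := by
  induction n with
  | zero =>
    obtain ⟨ψ, h1, h2, h3⟩ := h P
    refine ⟨ψ, fun s hs t ht _ => h2 s t ?_ ?_⟩
    · rw [abs_of_nonneg hs.1]; simpa using hs.2
    · rw [abs_of_nonneg ht.1]; simpa using ht.2
  | succ n ih =>
    obtain ⟨φ, hφ⟩ := ih
    set a : ℝ := (n + 1) * δ with ha
    have haδ : δ ≤ a := by rw [ha]; nlinarith [(Nat.cast_nonneg n : (0 : ℝ) ≤ n)]
    have hsucc : (((n + 1 : ℕ) : ℝ) + 1) * δ = a + δ := by rw [ha]; push_cast; ring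
    rw [hsucc]
    obtain ⟨ψ, h1, hQ, h2, h3⟩ := (h (φ a)).exists_oriented (Q := φ (a - δ)) hδ (by
      rw [hφ (a - δ) ⟨by linarith, by linarith⟩ a ⟨by linarith, le_rfl⟩ (by
        rw [abs_le]; constructor <;> linarith)]
      rw [abs_of_neg] <;> linarith)
    have hagree : ∀ u, -δ ≤ u → u ≤ 0 → φ (a + u) = ψ u := by
      intro u hu1 hu2
      have hd := hφ (a + u) ⟨by linarith, by linarith⟩ a ⟨by linarith, le_rfl⟩ (by
        rw [abs_le]; constructor <;> linarith)
      have hd' := hφ (a + u) ⟨by linarith, by linarith⟩ (a - δ) ⟨by linarith, by linarith⟩ (by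
        rw [abs_le]; constructor <;> linarith)
      rw [add_sub_cancel_left, abs_of_nonpos hu2] at hd
      have hu3 : a + u - (a - δ) = u + δ := by ring
      rw [hu3, abs_of_nonneg (by linarith)] at hd'
      obtain ⟨w, hw, hwu⟩ := h3 _ (hd.le.trans (by linarith))
      rw [← hwu, ← h1, h2 _ _ hw (by simpa using hδ.le), sub_zero] at hd
      rw [← hwu, ← hQ, h2 _ _ hw (by simp [abs_of_pos hδ]), sub_neg_eq_add] at hd'
      have hw' := abs_le.1 hw
      rw [abs_of_nonneg (by linarith)] at hd'
      rw [← hwu]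
      congr 1
      linarith
    have key : ∀ t, a - δ ≤ t → (if t ≤ a then φ t else ψ (t - a)) = ψ (t - a) := by
      intro t ht
      split_ifs with hta
      · rw [← hagree (t - a) (by linarith) (by linarith)]
        congr 1; ring
      · rfl
    refine ⟨fun t => if t ≤ a then φ t else ψ (t - a), fun s hs t ht hst => ?_⟩
    have hst' := abs_le.1 hst
    by_cases hc : s ≤ a ∧ t ≤ a
    · simp only [hc.1, hc.2, if_true]
      exact hφ s ⟨hs.1, hc.1⟩ t ⟨ht.1, hc.2⟩ hst
    · have hsa : a - δ ≤ s ∧ a - δ ≤ t := by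
        by_contra hcon
        apply hc
        by_cases hs' : a - δ ≤ s
        · have : ¬ (a - δ ≤ t) := fun h => hcon ⟨hs', h⟩
          constructor <;> linarith
        · constructor <;> linarith
      simp only [key s hsa.1, key t hsa.2]
      rw [h2 _ _ (abs_le.2 ⟨by linarith, by linarith [hs.2]⟩)
        (abs_le.2 ⟨by linarith, by linarith [ht.2]⟩)]
      congr 1; ring

theorem exists_isLocalGeodesic [CompactSpace γ] [Nonempty γ] (hδ : 0 < δ)
    (h : ∀ P : γ, HasLineChart δ P) : ∃ φ : ℝ → γ, IsLocalGeodesic δ φ := by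
  obtain ⟨P⟩ := ‹Nonempty γ›
  choose ψ hψ using fun n : ℕ => exists_geodesic_segment hδ h P (2 * n)
  have hlim : ∀ t : ℝ, ∃ x : γ,
      Filter.Tendsto (fun n : ℕ => ψ n (t + n * δ)) (Filter.hyperfilter ℕ) (nhds x) := by
    intro t
    obtain ⟨x, -, hx⟩ := isCompact_univ.ultrafilter_le_nhds
      ((Filter.hyperfilter ℕ).map fun n : ℕ => ψ n (t + n * δ)) (by simp)
    exact ⟨x, hx⟩
  choose φ hφ using hlim
  refine ⟨φ, fun s t hst => ?_⟩
  refine tendsto_nhds_unique ((hφ s).dist (hφ t)) (tendsto_const_nhds.congr' ?_)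
  have hev : ∀ᶠ n : ℕ in Filter.atTop, |s| ≤ n * δ ∧ |t| ≤ n * δ := by
    have ht := (tendsto_natCast_atTop_atTop (R := ℝ)).atTop_mul_const hδ
    exact (ht.eventually_ge_atTop |s|).and (ht.eventually_ge_atTop |t|)
  have hle : ((Filter.hyperfilter ℕ : Ultrafilter ℕ) : Filter ℕ) ≤ Filter.atTop := by
    rw [← Nat.cofinite_eq_atTop]
    exact Filter.hyperfilter_le_cofinite
  filter_upwards [hle hev] with n hn
  have hs := abs_le.1 hn.1
  have ht := abs_le.1 hn.2
  have hdiff : s + n * δ - (t + n * δ) = s - t := by ring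
  rw [hψ n (s + n * δ) ⟨by linarith, by push_cast; linarith⟩ (t + n * δ)
    ⟨by linarith, by push_cast; linarith⟩ (by rwa [hdiff]), hdiff]

end Geodesics

section Covering

variable {γ : Type*} [MetricSpace γ] {ρ : ℝ} {φ χ : ℝ → γ}

theorem IsLocalGeodesic.exists_eq_of_dist_le (hρ : 0 < ρ) (hφ : IsLocalGeodesic (2 * ρ) φ)
    (h : ∀ P : γ, HasLineChart (2 * ρ) P) {t : ℝ} {x : γ} (hx : dist x (φ t) ≤ ρ) :
    ∃ u : ℝ, |u| = dist x (φ t) ∧ φ (t + u) = x := by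
  have hd : dist (φ (t - ρ)) (φ t) = ρ := by
    rw [hφ _ _ (by rw [abs_le]; constructor <;> linarith)]
    rw [abs_of_neg] <;> linarith
  obtain ⟨ψ, h1, h2, h3⟩ := h (φ t)
  obtain ⟨a, ha, haφ⟩ := h3 (φ (t + ρ)) (by
    rw [hφ _ _ (by rw [abs_le]; constructor <;> linarith), abs_le]
    constructor <;> linarith)
  have h0 : |(0 : ℝ)| ≤ 2 * ρ := by simpa using hρ.le
  have haρ : |a| = ρ := by
    have := h2 a 0 ha h0
    rw [haφ, h1, hφ _ _ (by rw [abs_le]; constructor <;> linarith), sub_zero,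
      add_sub_cancel_left, abs_of_pos hρ] at this
    exact this.symm
  obtain ⟨c, hc, rfl⟩ := h3 x (by linarith)
  have hcd : dist (ψ c) (φ t) = |c| := by rw [← h1, h2 c 0 hc h0, sub_zero]
  rw [hcd] at hx ⊢
  obtain ⟨σ, hσ, rfl⟩ : ∃ σ : ℝ, (σ = 1 ∨ σ = -1) ∧ a = σ * ρ := by
    rcases (abs_eq hρ.le).1 haρ with rfl | rfl
    · exact ⟨1, Or.inl rfl, by ring⟩
    · exact ⟨-1, Or.inr rfl, by ring⟩
  have hσc : |σ * c| = |c| := by rcases hσ with rfl | rfl <;> simp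
  refine ⟨σ * c, hσc, ?_⟩
  have hσc' := abs_le.1 (hσc.le.trans hx)
  have hd1 := hφ (t + σ * c) t (by rw [abs_le]; constructor <;> linarith)
  have hd2 := hφ (t + σ * c) (t + ρ) (by rw [abs_le]; constructor <;> linarith)
  have he1 : t + σ * c - t = σ * c := by ring
  have he2 : t + σ * c - (t + ρ) = σ * c - ρ := by ring
  rw [he1] at hd1
  rw [he2] at hd2
  obtain ⟨w, hw, hwφ⟩ := h3 (φ (t + σ * c)) (by rw [hd1]; linarith [hσc.le.trans hx])
  rw [← hwφ, ← h1, h2 _ _ hw h0, sub_zero, hσc] at hd1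
  rw [← hwφ, ← haφ, h2 _ _ hw ha, abs_of_nonpos (by linarith : σ * c - ρ ≤ 0)] at hd2
  rw [← hwφ]
  congr 1
  have hw2 := abs_le.1 (hd1.le.trans hx)
  rcases hσ with rfl | rfl
  · rw [abs_of_nonpos (by linarith)] at hd2
    linarith
  · rw [abs_of_nonneg (by linarith)] at hd2
    linarith

theorem IsLocalGeodesic.comp_add_left {δ : ℝ} (hφ : IsLocalGeodesic δ φ) (a : ℝ) :
    IsLocalGeodesic δ fun t => φ (a + t) := by
  intro s t hst
  have : a + s - (a + t) = s - t := by ring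
  rw [hφ _ _ (by rwa [this]), this]

theorem IsLocalGeodesic.comp_sub_left {δ : ℝ} (hφ : IsLocalGeodesic δ φ) (a : ℝ) :
    IsLocalGeodesic δ fun t => φ (a - t) := by
  intro s t hst
  have : a - s - (a - t) = -(s - t) := by ring
  rw [hφ _ _ (by rwa [this, abs_neg]), this, abs_neg]

theorem IsLocalGeodesic.eq_near (hρ : 0 < ρ) (hφ : IsLocalGeodesic (2 * ρ) φ)
    (hχ : IsLocalGeodesic (2 * ρ) χ) (h : ∀ P : γ, HasLineChart (2 * ρ) P) {x c : ℝ}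
    (hc : |c| = ρ) (h0 : φ x = χ x) (h1 : φ (x + c) = χ (x + c)) {u : ℝ} (hu : |u| ≤ ρ) :
    φ (x + u) = χ (x + u) := by
  have hu' := abs_le.1 hu
  have hc' := abs_le.1 hc.le
  have hd0 := hφ (x + u) x (by rw [abs_le]; constructor <;> linarith)
  have hd1 := hφ (x + u) (x + c) (by rw [abs_le]; constructor <;> linarith)
  rw [add_sub_cancel_left] at hd0
  rw [add_sub_add_left_eq_sub] at hd1
  obtain ⟨w, hw, hwφ⟩ := hχ.exists_eq_of_dist_le hρ h (x := φ (x + u)) (t := x)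
    (by rw [← h0, hd0]; exact hu)
  rw [← h0, hd0] at hw
  have hw' := abs_le.1 (hw.le.trans hu)
  rw [h1, ← hwφ, hχ _ _ (by rw [abs_le]; constructor <;> linarith),
    add_sub_add_left_eq_sub] at hd1
  rw [← hwφ]
  congr 2
  rcases (abs_eq hρ.le).1 hc with rfl | rfl
  · rw [abs_of_nonpos (by linarith), abs_of_nonpos (by linarith)] at hd1
    linarith
  · rw [abs_of_nonneg (by linarith), abs_of_nonneg (by linarith)] at hd1
    linarith

theorem IsLocalGeodesic.eq_of_eq_of_eq (hρ : 0 < ρ) (hφ : IsLocalGeodesic (2 * ρ) φ)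
    (hχ : IsLocalGeodesic (2 * ρ) χ) (h : ∀ P : γ, HasLineChart (2 * ρ) P)
    (h0 : φ 0 = χ 0) (h1 : φ ρ = χ ρ) : φ = χ := by
  have key : ∀ n : ℕ, ∀ u : ℝ, |u| ≤ (n + 1) * ρ → φ u = χ u := by
    intro n
    induction n with
    | zero =>
      intro u hu
      have := hφ.eq_near hρ hχ h (x := 0) (c := ρ) (abs_of_pos hρ) h0 (by simpa using h1)
        (u := u) (by simpa using hu)
      simpa using this
    | succ n ih =>
      intro u hu
      have hn : (0 : ℝ) ≤ n := Nat.cast_nonneg n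
      have hnρ : 0 ≤ (n : ℝ) * ρ := by positivity
      push_cast at hu
      by_cases hu' : |u| ≤ (n + 1) * ρ
      · exact ih u hu'
      · rcases le_total 0 u with hpos | hneg
        · rw [abs_of_nonneg hpos] at hu hu'
          have := hφ.eq_near hρ hχ h (x := (n + 1) * ρ) (c := -ρ) (by simp [abs_of_pos hρ])
            (ih _ (by rw [abs_of_nonneg]; positivity))
            (ih _ (by rw [abs_of_nonneg] <;> linarith))
            (u := u - (n + 1) * ρ) (by rw [abs_le]; constructor <;> linarith)
          simpa using this
        · rw [abs_of_nonpos hneg] at hu hu'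
          have := hφ.eq_near hρ hχ h (x := -((n + 1) * ρ)) (c := ρ) (abs_of_pos hρ)
            (ih _ (by rw [abs_neg, abs_of_nonneg]; positivity))
            (ih _ (by rw [abs_of_nonpos] <;> linarith))
            (u := u + (n + 1) * ρ) (by rw [abs_le]; constructor <;> linarith)
          simpa using this
  funext u
  obtain ⟨n, hn⟩ := exists_nat_ge (|u| / ρ)
  refine key n u ?_
  rw [div_le_iff₀ hρ] at hn
  linarith

theorem IsLocalGeodesic.periodic_of_eq (hρ : 0 < ρ) (hφ : IsLocalGeodesic (2 * ρ) φ)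
    (h : ∀ P : γ, HasLineChart (2 * ρ) P) {s t : ℝ} (hst : φ s = φ t) :
    Function.Periodic φ (t - s) := by
  have hd : dist (φ (s + ρ)) (φ t) = ρ := by
    rw [← hst, hφ _ _ (by rw [abs_le]; constructor <;> linarith), add_sub_cancel_left,
      abs_of_pos hρ]
  obtain ⟨u, hu, hut⟩ := hφ.exists_eq_of_dist_le hρ h hd.le
  rw [hd] at hu
  rcases (abs_eq hρ.le).1 hu with rfl | rfl
  · have heq := (hφ.comp_add_left s).eq_of_eq_of_eq hρ (hφ.comp_add_left t) h
      (by simpa using hst) hut.symm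
    intro x
    have := congrFun heq (x - s)
    rw [show s + (x - s) = x by ring] at this
    rw [this]
    congr 1; ring
  · have heq := (hφ.comp_add_left s).eq_of_eq_of_eq hρ (hφ.comp_sub_left t) h
      (by simpa using hst) hut.symm
    have := congrFun heq ((t - s) / 2 + ρ)
    rw [← dist_eq_zero, hφ _ _ (by rw [abs_le]; constructor <;> linarith), abs_eq_zero] at this
    linarith

theorem IsLocalGeodesic.surjective [PreconnectedSpace γ] (hρ : 0 < ρ)
    (hφ : IsLocalGeodesic (2 * ρ) φ) (h : ∀ P : γ, HasLineChart (2 * ρ) P) :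
    Function.Surjective φ := by
  rw [← Set.range_eq_univ]
  refine IsClopen.eq_univ ⟨?_, ?_⟩ ⟨φ 0, 0, rfl⟩
  · refine isClosed_of_closure_subset fun x hx => ?_
    obtain ⟨_, ⟨t, rfl⟩, ht⟩ := Metric.mem_closure_iff.1 hx ρ hρ
    obtain ⟨u, -, hu⟩ := hφ.exists_eq_of_dist_le hρ h ht.le
    exact ⟨_, hu⟩
  · refine Metric.isOpen_iff.2 ?_
    rintro _ ⟨t, rfl⟩
    refine ⟨ρ, hρ, fun x hx => ?_⟩
    obtain ⟨u, -, hu⟩ := hφ.exists_eq_of_dist_le hρ h (le_of_lt hx)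
    exact ⟨_, hu⟩

theorem IsLocalGeodesic.exists_period [CompactSpace γ] (hρ : 0 < ρ)
    (hφ : IsLocalGeodesic (2 * ρ) φ) (h : ∀ P : γ, HasLineChart (2 * ρ) P) :
    ∃ L > 0, ∀ s t : ℝ, φ s = φ t ↔ ∃ k : ℤ, t = s + k * L := by
  obtain ⟨T, hT0, hT⟩ : ∃ T ≠ 0, Function.Periodic φ T := by
    obtain ⟨x, -, g, hg, hx⟩ := isCompact_univ.tendsto_subseq
      (x := fun n : ℕ => φ (4 * ρ * n)) (fun _ => Set.mem_univ _)
    obtain ⟨N, hN⟩ := Metric.cauchySeq_iff.1 hx.cauchySeq ρ hρ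
    obtain ⟨u, hu, hut⟩ := hφ.exists_eq_of_dist_le hρ h (hN N le_rfl (N + 1) (by simp)).le
    have hu' : |u| ≤ ρ := hu.le.trans (hN N le_rfl (N + 1) (by simp)).le
    refine ⟨_, ?_, hφ.periodic_of_eq hρ h hut⟩
    have hlt : (g N : ℝ) + 1 ≤ g (N + 1) := by exact_mod_cast hg (Nat.lt_succ_self N)
    have := abs_le.1 hu'
    have hmul := mul_le_mul_of_nonneg_left hlt hρ.le
    apply ne_of_lt
    linarith
  let H : AddSubgroup ℝ :=
    { carrier := {T | Function.Periodic φ T}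
      zero_mem' := fun x => by simp
      add_mem' := fun ha hb => ha.add_period hb
      neg_mem' := fun ha => ha.neg }
  obtain ⟨L, hL⟩ := AddSubgroup.cyclic_of_isolated_zero (H := H) hρ (by
    rw [Set.disjoint_left]
    rintro a (ha : Function.Periodic φ a) ⟨ha0, haρ⟩
    have h1 := hφ (0 + a) 0 (by rw [abs_le]; constructor <;> linarith)
    rw [ha 0, dist_self] at h1
    have := abs_eq_zero.1 h1.symm
    linarith)
  have hmem : ∀ a, Function.Periodic φ a ↔ ∃ k : ℤ, a = k * L := by
    intro a
    change a ∈ H ↔ _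
    rw [hL, AddSubgroup.mem_closure_singleton]
    simp [eq_comm]
  have hL0 : L ≠ 0 := by
    rintro rfl
    obtain ⟨k, hk⟩ := (hmem T).1 hT
    exact hT0 (by simpa using hk)
  have hiff : ∀ s t : ℝ, φ s = φ t ↔ ∃ k : ℤ, t = s + k * L := by
    intro s t
    refine ⟨fun hst => ?_, ?_⟩
    · obtain ⟨k, hk⟩ := (hmem _).1 (hφ.periodic_of_eq hρ h hst)
      exact ⟨k, by linarith⟩
    · rintro ⟨k, rfl⟩
      exact ((hmem _).2 ⟨k, rfl⟩ s).symm
  rcases lt_or_gt_of_ne hL0 with hneg | hpos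
  · refine ⟨-L, by linarith, fun s t => (hiff s t).trans ⟨?_, ?_⟩⟩
    · rintro ⟨k, rfl⟩
      exact ⟨-k, by push_cast; ring⟩
    · rintro ⟨k, rfl⟩
      exact ⟨-k, by push_cast; ring⟩
  · exact ⟨L, hpos, hiff⟩

/-- A locally isometric covering `ℝ → γ` with period lattice `ℤ L`. -/
structure IsCircleCovering (ρ L : ℝ) (φ : ℝ → γ) : Prop where
  scale_pos : 0 < ρ
  period_pos : 0 < L
  geodesic : IsLocalGeodesic (2 * ρ) φ
  lift : ∀ (t : ℝ) (x : γ), dist x (φ t) ≤ ρ → ∃ u : ℝ, |u| = dist x (φ t) ∧ φ (t + u) = x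
  surjective : Function.Surjective φ
  eq_iff : ∀ s t : ℝ, φ s = φ t ↔ ∃ k : ℤ, t = s + k * L

theorem exists_isCircleCovering (hγ : IsMetricGraph γ) (hcirc : ∀ P : γ, valence γ P = 2)
    (v : γ) : ∃ (ρ L : ℝ) (φ : ℝ → γ), IsCircleCovering ρ L φ ∧ φ 0 = v := by
  obtain ⟨_, _, hstar⟩ := hγ
  have h2 : ∀ P : γ, HasStarNbhd γ P 2 := by
    intro P
    have hmem := Nat.sInf_mem (s := {n : ℕ | 1 ≤ n ∧ HasStarNbhd γ P n}) (hstar P)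
    have hv : sInf {n : ℕ | 1 ≤ n ∧ HasStarNbhd γ P n} = 2 := hcirc P
    rw [hv] at hmem
    exact hmem.2
  obtain ⟨δ, hδ, hchart⟩ := exists_uniform_hasLineChart h2
  obtain ⟨ρ, rfl⟩ : ∃ ρ, δ = 2 * ρ := ⟨δ / 2, by ring⟩
  have hρ : 0 < ρ := by linarith
  obtain ⟨χ, hχ⟩ := exists_isLocalGeodesic hδ hchart
  obtain ⟨a, ha⟩ := hχ.surjective hρ hchart v
  have hφ := hχ.comp_add_left a
  obtain ⟨L, hL, hiff⟩ := hφ.exists_period hρ hchart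
  exact ⟨ρ, L, _, ⟨hρ, hL, hφ, fun t x hx => hφ.exists_eq_of_dist_le hρ hchart hx,
    hφ.surjective hρ hchart, hiff⟩, by simpa using ha⟩

end Covering

section PiecewiseLinear

/-- `g` is piecewise affine with integer slopes, and at every `x` the sum of its two outgoing
slopes is `o x`. -/
def HasOrders (g : ℝ → ℝ) (o : ℝ → ℤ) : Prop :=
  ∀ x, ∃ p m : ℤ, (∃ ε > 0, ∀ t ∈ Set.Icc (0 : ℝ) ε,
    g (x + t) = g x + p * t ∧ g (x - t) = g x + m * t) ∧ p + m = o x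

theorem HasOrders.add {g₁ g₂ : ℝ → ℝ} {o₁ o₂ : ℝ → ℤ} (h₁ : HasOrders g₁ o₁)
    (h₂ : HasOrders g₂ o₂) : HasOrders (g₁ + g₂) (o₁ + o₂) := by
  intro x
  obtain ⟨p₁, m₁, ⟨ε₁, hε₁, hs₁⟩, ho₁⟩ := h₁ x
  obtain ⟨p₂, m₂, ⟨ε₂, hε₂, hs₂⟩, ho₂⟩ := h₂ x
  refine ⟨p₁ + p₂, m₁ + m₂, ⟨min ε₁ ε₂, lt_min hε₁ hε₂, fun t ht => ?_⟩, ?_⟩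
  · obtain ⟨ha, hb⟩ := hs₁ t ⟨ht.1, ht.2.trans (min_le_left _ _)⟩
    obtain ⟨hc, hd⟩ := hs₂ t ⟨ht.1, ht.2.trans (min_le_right _ _)⟩
    simp only [Pi.add_apply, ha, hb, hc, hd]
    push_cast
    constructor <;> ring
  · rw [Pi.add_apply, ← ho₁, ← ho₂]; ring

theorem HasOrders.neg {g : ℝ → ℝ} {o : ℝ → ℤ} (h : HasOrders g o) : HasOrders (-g) (-o) := by
  intro x
  obtain ⟨p, m, ⟨ε, hε, hs⟩, ho⟩ := h x
  refine ⟨-p, -m, ⟨ε, hε, fun t ht => ?_⟩, by rw [Pi.neg_apply, ← ho]; ring⟩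
  obtain ⟨ha, hb⟩ := hs t ht
  simp only [Pi.neg_apply, ha, hb]
  push_cast
  constructor <;> ring

theorem HasOrders.comp_sub_right {g : ℝ → ℝ} {o : ℝ → ℤ} (h : HasOrders g o) (a : ℝ) :
    HasOrders (fun x => g (x - a)) fun x => o (x - a) := by
  intro x
  obtain ⟨p, m, ⟨ε, hε, hs⟩, ho⟩ := h (x - a)
  refine ⟨p, m, ⟨ε, hε, fun t ht => ?_⟩, ho⟩
  simp only [add_sub_right_comm, sub_right_comm x t a]
  exact hs t ht

theorem HasOrders.continuous {g : ℝ → ℝ} {o : ℝ → ℤ} (h : HasOrders g o) : Continuous g := by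
  rw [continuous_iff_continuousAt]
  intro x
  obtain ⟨p, m, ⟨ε, hε, hs⟩, -⟩ := h x
  rw [continuousAt_iff_continuous_left_right]
  constructor
  · have hc : ContinuousWithinAt (fun y => g x + m * (x - y)) (Set.Iic x) x := by fun_prop
    refine hc.congr_of_eventuallyEq ?_ (by simp)
    filter_upwards [self_mem_nhdsWithin, nhdsWithin_le_nhds (Ioi_mem_nhds (sub_lt_self x hε))]
      with y (hy : y ≤ x) (hy' : x - ε < y)
    rw [← (hs (x - y) ⟨by linarith, by linarith⟩).2, sub_sub_cancel]
  · have hc : ContinuousWithinAt (fun y => g x + p * (y - x)) (Set.Ici x) x := by fun_prop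
    refine hc.congr_of_eventuallyEq ?_ (by simp)
    filter_upwards [self_mem_nhdsWithin, nhdsWithin_le_nhds (Iio_mem_nhds (lt_add_of_pos_right x hε))]
      with y (hy : x ≤ y) (hy' : y < x + ε)
    rw [← (hs (y - x) ⟨by linarith, by linarith⟩).1, add_sub_cancel]

/-- The tropical theta function: convex, piecewise linear, with slope `k` on `[k L, (k + 1) L]`. -/
noncomputable def tropicalTheta (L x : ℝ) : ℝ :=
  ⌊x / L⌋ * x - L * (⌊x / L⌋ * (⌊x / L⌋ + 1) / 2)

variable {L : ℝ}

theorem tropicalTheta_eq (hL : 0 < L) {x : ℝ} (k : ℤ) (h₁ : k * L ≤ x) (h₂ : x ≤ (k + 1) * L) :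
    tropicalTheta L x = k * x - L * (k * (k + 1) / 2) := by
  rcases h₂.lt_or_eq with h₂ | rfl
  · have : ⌊x / L⌋ = k := by
      rw [Int.floor_eq_iff, le_div_iff₀ hL, div_lt_iff₀ hL]
      exact ⟨h₁, h₂⟩
    rw [tropicalTheta, this]
  · have : ⌊((k : ℝ) + 1) * L / L⌋ = k + 1 := by
      rw [mul_div_cancel_right₀ _ hL.ne']
      exact_mod_cast Int.floor_intCast (k + 1)
    rw [tropicalTheta, this]
    push_cast
    ring

theorem tropicalTheta_add_period (hL : 0 < L) (x : ℝ) :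
    tropicalTheta L (x + L) = tropicalTheta L x + x := by
  have : ⌊(x + L) / L⌋ = ⌊x / L⌋ + 1 := by
    rw [add_div, div_self hL.ne', Int.floor_add_one]
  rw [tropicalTheta, tropicalTheta, this]
  push_cast
  ring

open Classical in
theorem hasOrders_tropicalTheta (hL : 0 < L) :
    HasOrders (tropicalTheta L) fun x => if ∃ k : ℤ, x = k * L then 1 else 0 := by
  intro x
  by_cases hx : ∃ k : ℤ, x = k * L
  · simp only [if_pos hx]
    obtain ⟨k, rfl⟩ := hx
    refine ⟨k, -(k - 1), ⟨L, hL, fun t ht => ⟨?_, ?_⟩⟩, by ring⟩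
    · rw [tropicalTheta_eq hL k (by linarith [ht.1]) (by linarith [ht.2]),
        tropicalTheta_eq hL k le_rfl (by linarith)]
      ring
    · rw [tropicalTheta_eq hL (k - 1) (by push_cast; linarith [ht.2])
          (by push_cast; linarith [ht.1]),
        tropicalTheta_eq hL k le_rfl (by linarith)]
      push_cast
      ring
  · simp only [if_neg hx]
    set k := ⌊x / L⌋ with hk
    have h₁ : k * L < x := by
      refine lt_of_le_of_ne ?_ fun h => hx ⟨k, h.symm⟩
      rw [← le_div_iff₀ hL]
      exact Int.floor_le _
    have h₂ : x < (k + 1) * L := by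
      rw [← div_lt_iff₀ hL]
      exact Int.lt_floor_add_one _
    refine ⟨k, -k, ⟨min (x - k * L) ((k + 1) * L - x), lt_min (by linarith) (by linarith),
      fun t ht => ?_⟩, by ring⟩
    have ht₁ := ht.2.trans (min_le_left _ _)
    have ht₂ := ht.2.trans (min_le_right _ _)
    have ht₀ := ht.1
    rw [tropicalTheta_eq hL k (by linarith) (by linarith),
      tropicalTheta_eq hL k (by linarith) (by linarith),
      tropicalTheta_eq hL k (by linarith) (by linarith)]
    push_cast
    constructor <;> ring

end PiecewiseLinear

section LiftedLinEquiv

variable {γ : Type*} {L : ℝ} {φ : ℝ → γ}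

/-- `D₂ - D₁` is the divisor of an `L`-periodic piecewise linear function on `ℝ`. -/
def LiftedLinEquiv (L : ℝ) (φ : ℝ → γ) (D₁ D₂ : Divisor γ) : Prop :=
  ∃ g : ℝ → ℝ, Function.Periodic g L ∧ HasOrders g fun x => D₂ (φ x) - D₁ (φ x)

theorem LiftedLinEquiv.refl (D : Divisor γ) : LiftedLinEquiv L φ D D :=
  ⟨0, fun _ => rfl, fun x => ⟨0, 0, ⟨1, one_pos, by simp⟩, by simp⟩⟩

theorem LiftedLinEquiv.add {D₁ D₂ D₃ D₄ : Divisor γ} (h : LiftedLinEquiv L φ D₁ D₂)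
    (h' : LiftedLinEquiv L φ D₃ D₄) : LiftedLinEquiv L φ (D₁ + D₃) (D₂ + D₄) := by
  obtain ⟨g, hg, ho⟩ := h
  obtain ⟨g', hg', ho'⟩ := h'
  refine ⟨g + g', hg.add hg', ?_⟩
  convert ho.add ho' using 2 with x
  simp only [Finsupp.add_apply, Pi.add_apply]
  ring

theorem LiftedLinEquiv.of_add_right {D₁ D₂ D : Divisor γ}
    (h : LiftedLinEquiv L φ (D₁ + D) (D₂ + D)) : LiftedLinEquiv L φ D₁ D₂ := by
  obtain ⟨g, hg, ho⟩ := h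
  refine ⟨g, hg, ?_⟩
  convert ho using 2 with x
  simp only [Finsupp.add_apply]
  ring

theorem LiftedLinEquiv.trans {D₁ D₂ D₃ : Divisor γ} (h : LiftedLinEquiv L φ D₁ D₂)
    (h' : LiftedLinEquiv L φ D₂ D₃) : LiftedLinEquiv L φ D₁ D₃ :=
  of_add_right (D := D₂) (by simpa [add_comm D₂] using h.add h')

theorem ArcEquiv.symm {τ τ' : ℝ → γ} (h : ArcEquiv τ τ') : ArcEquiv τ' τ := by
  obtain ⟨ε, hε, h⟩ := h
  exact ⟨ε, hε, fun t ht => (h t ht).symm⟩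

theorem HasSlopeAlong.congr_arc {f : γ → ℝ} {τ τ' : ℝ → γ} {s : ℤ} (h : HasSlopeAlong f τ s)
    (hτ : ArcEquiv τ' τ) : HasSlopeAlong f τ' s := by
  obtain ⟨ε, hε, h⟩ := h
  obtain ⟨ε', hε', h'⟩ := hτ
  refine ⟨min ε ε', lt_min hε hε', fun t ht => ?_⟩
  rw [h' t ⟨ht.1, ht.2.trans (min_le_right _ _)⟩, h' 0 ⟨le_rfl, hε'.le⟩,
    h t ⟨ht.1, ht.2.trans (min_le_left _ _)⟩]

theorem divDeg_add (D₁ D₂ : Divisor γ) : divDeg (D₁ + D₂) = divDeg D₁ + divDeg D₂ :=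
  Finsupp.sum_add_index' (fun _ => rfl) fun _ _ _ => rfl

theorem divDeg_single (P : γ) (n : ℤ) : divDeg (Finsupp.single P n) = n :=
  Finsupp.sum_single_index rfl

/-- An effective divisor of positive degree contains a point. -/
theorem Effective.exists_eq_add_single {F : Divisor γ} (hF : Effective F) {n : ℕ}
    (hn : divDeg F = ((n + 1 : ℕ) : ℤ)) :
    ∃ (F' : Divisor γ) (P : γ), Effective F' ∧ divDeg F' = n ∧ F = F' + Finsupp.single P 1 := by
  classical
  obtain ⟨P, hP⟩ : ∃ P, F P ≠ 0 := by
    by_contra! h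
    have : F = 0 := Finsupp.ext h
    rw [this, divDeg, Finsupp.sum_zero_index] at hn
    omega
  have hF' : F = (F - Finsupp.single P 1) + Finsupp.single P 1 := by simp
  refine ⟨F - Finsupp.single P 1, P, fun Q => ?_, ?_, hF'⟩
  · have hQ := hF Q
    have hPp := hF P
    rw [Finsupp.sub_apply, Finsupp.single_apply]
    split_ifs with h
    · subst h; omega
    · omega
  · have := congrArg divDeg hF'
    rw [divDeg_add, divDeg_single, hn] at this
    push_cast at this
    linarith

theorem Effective.eq_zero_of_divDeg {F : Divisor γ} (hF : Effective F)
    (h : divDeg F = 0) : F = 0 := by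
  ext P
  by_contra hP
  have := (Finset.sum_eq_zero_iff_of_nonneg fun Q _ => hF Q).1 h P (Finsupp.mem_support_iff.2 hP)
  exact hP this

end LiftedLinEquiv

section Divisors

variable {γ : Type*} [MetricSpace γ] {ρ L : ℝ} {φ : ℝ → γ}

open Classical in
theorem IsCircleCovering.hasOrders_theta (hφ : IsCircleCovering ρ L φ) (a : ℝ) :
    HasOrders (fun x => tropicalTheta L (x - a)) fun x => Finsupp.single (φ a) (1 : ℤ) (φ x) := by
  convert (hasOrders_tropicalTheta hφ.period_pos).comp_sub_right a using 2 with x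
  rw [Finsupp.single_apply]
  congr 1
  rw [hφ.eq_iff]
  simp only [sub_eq_iff_eq_add']

theorem IsCircleCovering.single_add_single (hφ : IsCircleCovering ρ L φ) (a b : ℝ) :
    LiftedLinEquiv L φ (Finsupp.single (φ a) 1 + Finsupp.single (φ b) 1)
      (Finsupp.single (φ 0) 1 + Finsupp.single (φ (a + b)) 1) := by
  refine ⟨fun x => tropicalTheta L (x - 0) + tropicalTheta L (x - (a + b))
    + -(tropicalTheta L (x - a) + tropicalTheta L (x - b)), fun x => ?_, ?_⟩
  · have h (c : ℝ) : tropicalTheta L (x + L - c) = tropicalTheta L (x - c) + (x - c) := by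
      rw [add_sub_right_comm, tropicalTheta_add_period hφ.period_pos]
    simp only [h]
    ring
  · convert ((hφ.hasOrders_theta 0).add (hφ.hasOrders_theta (a + b))).add
      ((hφ.hasOrders_theta a).add (hφ.hasOrders_theta b)).neg using 1 <;>
    funext x <;>
    simp only [Finsupp.add_apply, Pi.add_apply, Pi.neg_apply, sub_eq_add_neg]

theorem IsCircleCovering.isArcAt_add (hφ : IsCircleCovering ρ L φ) (x : ℝ) :
    IsArcAt (φ x) fun t => φ (x + t) := by
  refine ⟨by simp, ρ, hφ.scale_pos, fun s hs t ht => hφ.geodesic.comp_add_left x s t ?_⟩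
  rw [abs_le]
  constructor <;> linarith [hs.1, hs.2, ht.1, ht.2]

theorem IsCircleCovering.isArcAt_sub (hφ : IsCircleCovering ρ L φ) (x : ℝ) :
    IsArcAt (φ x) fun t => φ (x - t) := by
  refine ⟨by simp, ρ, hφ.scale_pos, fun s hs t ht => hφ.geodesic.comp_sub_left x s t ?_⟩
  rw [abs_le]
  constructor <;> linarith [hs.1, hs.2, ht.1, ht.2]

theorem IsCircleCovering.not_arcEquiv (hφ : IsCircleCovering ρ L φ) (x : ℝ) :
    ¬ ArcEquiv (fun t => φ (x + t)) fun t => φ (x - t) := by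
  rintro ⟨ε, hε, h⟩
  have hρ := hφ.scale_pos
  have hpos : 0 < min ε ρ := lt_min hε hρ
  have hle : min ε ρ ≤ ρ := min_le_right _ _
  have := h (min ε ρ) ⟨hpos.le, min_le_left _ _⟩
  simp only at this
  rw [← dist_eq_zero, hφ.geodesic _ _ (by rw [abs_le]; constructor <;> linarith),
    abs_eq_zero] at this
  linarith

theorem IsCircleCovering.arcEquiv_of_isArcAt (hφ : IsCircleCovering ρ L φ) {x : ℝ} {σ : ℝ → γ}
    (hσ : IsArcAt (φ x) σ) :
    ArcEquiv σ (fun t => φ (x + t)) ∨ ArcEquiv σ fun t => φ (x - t) := by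
  obtain ⟨hσ0, a, ha, hiso⟩ := hσ
  have hρ := hφ.scale_pos
  set e := min a ρ
  have he : 0 < e := lt_min ha hρ
  have hea : e ≤ a := min_le_left _ _
  have heρ : e ≤ ρ := min_le_right _ _
  have hlift : ∀ t ∈ Set.Icc 0 e, ∃ u, |u| = t ∧ φ (x + u) = σ t := by
    intro t ht
    have hd : dist (σ t) (φ x) = t := by
      rw [← hσ0, hiso t ⟨ht.1, ht.2.trans hea⟩ 0 ⟨le_rfl, ha.le⟩, sub_zero, abs_of_nonneg ht.1]
    have := hφ.lift x (σ t) (by rw [hd]; exact ht.2.trans heρ)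
    rwa [hd] at this
  obtain ⟨w, hw, hwσ⟩ := hlift e ⟨he.le, le_rfl⟩
  have key : ∀ t ∈ Set.Icc 0 e, ∃ u, φ (x + u) = σ t ∧ |u| = t ∧ |u - w| = e - t := by
    intro t ht
    obtain ⟨u, hu, hut⟩ := hlift t ht
    refine ⟨u, hut, hu, ?_⟩
    have hu' := abs_le.1 hu.le
    have hw' := abs_le.1 hw.le
    have hd := hφ.geodesic (x + u) (x + w) (by
      rw [abs_le]; constructor <;> linarith [ht.2])
    rw [hut, hwσ, hiso t ⟨ht.1, ht.2.trans hea⟩ e ⟨he.le, hea⟩, add_sub_add_left_eq_sub,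
      abs_of_nonpos (by linarith [ht.2])] at hd
    linarith
  rcases (abs_eq he.le).1 hw with h | h
  · refine Or.inl ⟨e, he, fun t ht => ?_⟩
    obtain ⟨u, hut, h1, h2⟩ := key t ht
    have hu : u = t := by
      rw [h] at h2
      have hu1 := abs_le.1 h1.le
      rw [abs_of_nonpos (by linarith [ht.2])] at h2
      linarith
    rw [← hut, hu]
  · refine Or.inr ⟨e, he, fun t ht => ?_⟩
    obtain ⟨u, hut, h1, h2⟩ := key t ht
    have hu : u = -t := by
      rw [h] at h2
      have hu1 := abs_le.1 h1.le
      rw [abs_of_nonneg (by linarith [ht.2])] at h2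
      linarith
    rw [← hut, hu, ← sub_eq_add_neg]

theorem IsCircleCovering.linEquiv (hφ : IsCircleCovering ρ L φ) {D₁ D₂ : Divisor γ}
    (h : LiftedLinEquiv L φ D₁ D₂) : LinEquiv γ D₁ D₂ := by
  obtain ⟨g, hg, ho⟩ := h
  obtain ⟨f, hf⟩ : ∃ f : γ → ℝ, ∀ x, f (φ x) = g x := by
    refine ⟨fun P => g (Function.surjInv hφ.surjective P), fun x => ?_⟩
    obtain ⟨k, hk⟩ := (hφ.eq_iff _ _).1 (Function.surjInv_eq hφ.surjective (φ x))
    have := hg.int_mul k (Function.surjInv hφ.surjective (φ x))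
    rw [← hk] at this
    exact this.symm
  have hslope : ∀ x, ∃ p m : ℤ, HasSlopeAlong f (fun t => φ (x + t)) p ∧
      HasSlopeAlong f (fun t => φ (x - t)) m ∧ p + m = D₂ (φ x) - D₁ (φ x) := by
    intro x
    obtain ⟨p, m, ⟨ε, hε, hs⟩, hpm⟩ := ho x
    refine ⟨p, m, ⟨ε, hε, fun t ht => ?_⟩, ⟨ε, hε, fun t ht => ?_⟩, hpm⟩
    · simpa only [hf, add_zero] using (hs t ht).1
    · simpa only [hf, sub_zero] using (hs t ht).2
  refine ⟨f, ⟨?_, ?_⟩, ?_⟩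
  · rw [Metric.continuous_iff]
    intro P ε hε
    obtain ⟨x, rfl⟩ := hφ.surjective P
    obtain ⟨η, hη, hgη⟩ := Metric.continuous_iff.1 ho.continuous x ε hε
    refine ⟨min η ρ, lt_min hη hφ.scale_pos, fun y hy => ?_⟩
    obtain ⟨u, hu, rfl⟩ := hφ.lift x y (hy.le.trans (min_le_right _ _))
    rw [hf, hf]
    refine hgη _ ?_
    rw [Real.dist_eq, add_sub_cancel_left, hu]
    exact hy.trans_le (min_le_left _ _)
  · intro P τ hτ
    obtain ⟨x, rfl⟩ := hφ.surjective P
    obtain ⟨p, m, hp, hm, -⟩ := hslope x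
    rcases hφ.arcEquiv_of_isArcAt hτ with h | h
    · exact ⟨p, hp.congr_arc h⟩
    · exact ⟨m, hm.congr_arc h⟩
  · intro P
    obtain ⟨x, rfl⟩ := hφ.surjective P
    obtain ⟨p, m, hp, hm, hpm⟩ := hslope x
    refine ⟨2, ![fun t => φ (x + t), fun t => φ (x - t)], ![p, m], ?_, ?_, ?_, ?_, ?_⟩
    · rw [Fin.forall_fin_two]
      exact ⟨hφ.isArcAt_add x, hφ.isArcAt_sub x⟩
    · intro i j hij
      fin_cases i <;> fin_cases j
      · exact absurd rfl hij
      · exact hφ.not_arcEquiv x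
      · exact fun h => hφ.not_arcEquiv x h.symm
      · exact absurd rfl hij
    · intro σ hσ
      rw [Fin.exists_fin_two]
      exact hφ.arcEquiv_of_isArcAt hσ
    · rw [Fin.forall_fin_two]
      exact ⟨hp, hm⟩
    · rw [Fin.sum_univ_two]
      exact hpm.symm

/-- Abel's theorem on the circle: an effective divisor of degree `n` is determined up to linear
equivalence by its sum in the circle group. -/
theorem IsCircleCovering.exists_add_single (hφ : IsCircleCovering ρ L φ) (n : ℕ)
    {F : Divisor γ} (hF : Effective F) (hn : divDeg F = n) :
    ∃ y : ℝ, LiftedLinEquiv L φ (F + Finsupp.single (φ 0) 1)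
      (Finsupp.single (φ 0) (n : ℤ) + Finsupp.single (φ y) 1) := by
  induction n generalizing F with
  | zero =>
    obtain rfl := hF.eq_zero_of_divDeg (by simpa using hn)
    exact ⟨0, by simpa using LiftedLinEquiv.refl _⟩
  | succ n ih =>
    obtain ⟨F', P, hF', hn', rfl⟩ := hF.exists_eq_add_single hn
    obtain ⟨x, rfl⟩ := hφ.surjective P
    obtain ⟨y, hy⟩ := ih hF' hn'
    refine ⟨y + x, ?_⟩
    have h₁ := hy.add (LiftedLinEquiv.refl (Finsupp.single (φ x) 1))
    have h₂ := (LiftedLinEquiv.refl (Finsupp.single (φ 0) (n : ℤ))).add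
      (hφ.single_add_single y x)
    rw [← add_assoc] at h₂
    have h := h₁.trans h₂
    rw [← add_assoc, ← Finsupp.single_add, add_right_comm] at h
    exact_mod_cast h

end Divisors

/-- On a circle graph `γ` with a point `v` : (1) for every effective
divisor `F` of degree `n` there is a point `Q` with `F + Q` linearly equivalent to
`(n + 1)·v`; (2) every effective divisor of degree `n ≥ 1` is linearly equivalent to
`m·v + E` with `m ≥ 0` and `E` effective of degree at most `1`. -/
theorem statement13 (γ : Type) [MetricSpace γ] (hγ : IsMetricGraph γ)
    (hcirc : ∀ P : γ, valence γ P = 2) (v : γ) :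
    (∀ (n : ℕ) (F : Divisor γ), Effective F → divDeg F = (n : ℤ) →
      ∃ Q : γ, LinEquiv γ (F + Finsupp.single Q 1) (Finsupp.single v ((n : ℤ) + 1))) ∧
    (∀ (n : ℕ), 1 ≤ n → ∀ F : Divisor γ, Effective F → divDeg F = (n : ℤ) →
      ∃ (m : ℕ) (E : Divisor γ), Effective E ∧ divDeg E ≤ 1 ∧
        LinEquiv γ F (Finsupp.single v (m : ℤ) + E)) := by
  obtain ⟨ρ, L, φ, hφ, rfl⟩ := exists_isCircleCovering hγ hcirc v
  refine ⟨fun n F hF hn => ?_, fun n hn1 F hF hn => ?_⟩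
  · obtain ⟨y, hy⟩ := hφ.exists_add_single n hF hn
    refine ⟨φ (-y), hφ.linEquiv (LiftedLinEquiv.of_add_right (D := Finsupp.single (φ 0) 1) ?_)⟩
    have h₁ := hy.add (LiftedLinEquiv.refl (Finsupp.single (φ (-y)) 1))
    have h₂ := (LiftedLinEquiv.refl (Finsupp.single (φ 0) (n : ℤ))).add
      (hφ.single_add_single y (-y))
    rw [← add_assoc] at h₂
    have h := h₁.trans h₂
    rw [← add_assoc, ← Finsupp.single_add, add_right_comm, add_neg_cancel] at h
    exact h
  · obtain ⟨m, rfl⟩ : ∃ m, n = m + 1 := ⟨n - 1, by omega⟩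
    obtain ⟨y, hy⟩ := hφ.exists_add_single (m + 1) hF hn
    refine ⟨m, Finsupp.single (φ y) 1, fun P => ?_, (divDeg_single _ _).le,
      hφ.linEquiv (LiftedLinEquiv.of_add_right (D := Finsupp.single (φ 0) 1) ?_)⟩
    · classical
      rw [Finsupp.single_apply]
      split_ifs <;> simp
    · rw [add_right_comm, ← Finsupp.single_add]
      exact_mod_cast hy
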